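/- Let E ⊂ R^d be compact with C^{1,1} boundary, 0 ∈ ∂E, satisfying an interior and exterior tangent ball condition of radius δ at 0. Then lim_{s→0−} (K^s(0, E) − d ω_d / s) = H^0(0, E), where K^s is the s-Riesz curvature and H^0 is the 0-fractional curvature. In particular, s · K^s(0,E) → d ω_d as s → 0−. -/

import Mathlib

open MeasureTheory Metric Filter Set

/-- Volume of the unit ball in `ℝ^d` (the constant `ω_d`). -/
noncomputable def unitBallVol (d : ℕ) : ℝ :=
  (volume (Metric.ball (0 : EuclideanSpace ℝ (Fin d)) 1)).toReal

/-- `χ_{ℝ^d ∖ E}(y) - χ_E(y)`. -/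
noncomputable def chiDiff {d : ℕ} (E : Set (EuclideanSpace ℝ (Fin d)))
    (y : EuclideanSpace ℝ (Fin d)) : ℝ :=
  Set.indicator Eᶜ (fun _ => (1:ℝ)) y - Set.indicator E (fun _ => (1:ℝ)) y

/-- The unit vector `e_d` (last coordinate direction) in `ℝ^d`. -/
noncomputable def ed (d : ℕ) : EuclideanSpace ℝ (Fin d) :=
  if h : 0 < d then EuclideanSpace.single (⟨d - 1, by omega⟩ : Fin d) 1 else 0

/-- `H` is the value of the `s`-fractional curvature of `E` at `x`, defined as the
principal value `lim_{r→0⁺} ∫_{ℝ^d ∖ B_r(x)} (χ_{Eᶜ}(y) - χ_E(y))/|x-y|^{d+s} dy`. -/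
def HasFracCurv {d : ℕ} (s : ℝ) (E : Set (EuclideanSpace ℝ (Fin d)))
    (x : EuclideanSpace ℝ (Fin d)) (H : ℝ) : Prop :=
  Tendsto (fun r : ℝ => ∫ y in (Metric.ball x r)ᶜ, chiDiff E y / ‖y - x‖ ^ ((d:ℝ) + s))
    (nhdsWithin 0 (Set.Ioi 0)) (nhds H)

/-- Uniform two-sided (interior and exterior) tangent ball condition: the standard
geometric characterization of a set with compact boundary of class `C^{1,1}`. -/
def TwoSidedBallCond {d : ℕ} (E : Set (EuclideanSpace ℝ (Fin d))) : Prop :=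
  ∃ δ > 0, ∀ x ∈ frontier E, ∃ ν : EuclideanSpace ℝ (Fin d), ‖ν‖ = 1 ∧
    Metric.ball (x - δ • ν) δ ⊆ E ∧ Metric.ball (x + δ • ν) δ ⊆ Eᶜ

/-- The `0`-fractional curvature `H^0(x,E)`, defined with the cutoff radius
`R = diam E + 1 > diam E` (the value is independent of the choice of `R > diam E`). -/
noncomputable def H0 {d : ℕ} (E : Set (EuclideanSpace ℝ (Fin d)))
    (x : EuclideanSpace ℝ (Fin d)) : ℝ :=
  limUnder (nhdsWithin (0:ℝ) (Set.Ioi 0))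
    (fun r => ∫ y in Metric.ball x (Metric.diam E + 1) \ Metric.ball x r,
      chiDiff E y / ‖y - x‖ ^ (d:ℝ))
  - d * unitBallVol d * Real.log (Metric.diam E + 1)

/-- The `s`-Riesz curvature `K^s(x,E) = -2 ∫_E |x-y|^{-(d+s)} dy` of a compact set. -/
noncomputable def Ks {d : ℕ} (s : ℝ) (E : Set (EuclideanSpace ℝ (Fin d)))
    (x : EuclideanSpace ℝ (Fin d)) : ℝ :=
  -2 * ∫ y in E, 1 / ‖x - y‖ ^ ((d:ℝ) + s)

/-- Outer Minkowski curvature `κ_r^{ou}(x,E)` relative to a normal (vector) field `ν`. -/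
noncomputable def kappaOut {d : ℕ} (E : Set (EuclideanSpace ℝ (Fin d)))
    (ν : EuclideanSpace ℝ (Fin d) → EuclideanSpace ℝ (Fin d)) (r : ℝ)
    (x : EuclideanSpace ℝ (Fin d)) : ℝ :=
  if Metric.infDist (x + r • ν x) E = r then
    (1 / (2 * r)) * LinearMap.det
      ((ContinuousLinearMap.id ℝ (EuclideanSpace ℝ (Fin d)) + r • fderiv ℝ ν x).toLinearMap)
  else 0

/-- Inner Minkowski curvature `κ_r^{in}(x,E)` relative to a normal (vector) field `ν`. -/
noncomputable def kappaIn {d : ℕ} (E : Set (EuclideanSpace ℝ (Fin d)))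
    (ν : EuclideanSpace ℝ (Fin d) → EuclideanSpace ℝ (Fin d)) (r : ℝ)
    (x : EuclideanSpace ℝ (Fin d)) : ℝ :=
  if Metric.infDist (x - r • ν x) Eᶜ = r then
    -(1 / (2 * r)) * LinearMap.det
      ((ContinuousLinearMap.id ℝ (EuclideanSpace ℝ (Fin d)) - r • fderiv ℝ ν x).toLinearMap)
  else 0

/-- Regularized Minkowski curvature `κ_r^f(x,E) = ∫_0^1 (-s f'(s)) κ_{rs}(x,E) ds`. -/
noncomputable def kappaF {d : ℕ} (f : ℝ → ℝ) (E : Set (EuclideanSpace ℝ (Fin d)))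
    (ν : EuclideanSpace ℝ (Fin d) → EuclideanSpace ℝ (Fin d)) (r : ℝ)
    (x : EuclideanSpace ℝ (Fin d)) : ℝ :=
  ∫ t in Set.Ioc (0:ℝ) 1, (-t * deriv f t) * (kappaOut E ν (r*t) x + kappaIn E ν (r*t) x)

open Topology

section RadialPowers

variable {F : Type*} [NormedAddCommGroup F] [NormedSpace ℝ F] [FiniteDimensional ℝ F]
  [MeasurableSpace F] [BorelSpace F]

lemma integrableOn_ball_norm_rpow [Nontrivial F] (μ : Measure F) [μ.IsAddHaarMeasure] {q : ℝ}
    (hq : q < Module.finrank ℝ F) (R : ℝ) :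
    IntegrableOn (fun y : F => ‖y‖ ^ (-q)) (ball 0 R) μ := by
  refine integrableOn_ball_of_norm_le_rpow (C := 1) Module.finrank_pos hq ?_ ?_
  · refine Eventually.of_forall fun y => ?_
    rw [one_mul, Real.norm_of_nonneg (by positivity)]
  · exact (measurable_norm.pow_const _).aestronglyMeasurable

lemma integral_ball_norm_rpow [Nontrivial F] (μ : Measure F) [μ.IsAddHaarMeasure] {q : ℝ}
    (hq : q < Module.finrank ℝ F) {R : ℝ} (hR : 0 ≤ R) :
    ∫ y in ball (0 : F) R, ‖y‖ ^ (-q) ∂μ =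
      Module.finrank ℝ F * μ.real (ball 0 1) *
        (R ^ ((Module.finrank ℝ F : ℝ) - q) / (Module.finrank ℝ F - q)) := by
  have hn : 1 ≤ Module.finrank ℝ F := Module.finrank_pos
  have hind : (ball (0 : F) R).indicator (fun y => ‖y‖ ^ (-q)) =
      fun y => (Iio R).indicator (fun t : ℝ => t ^ (-q)) ‖y‖ := by
    ext y
    simp [indicator]
  rw [← integral_indicator measurableSet_ball, hind,
    integral_fun_norm_addHaar μ ((Iio R).indicator fun t : ℝ => t ^ (-q))]
  have hrad : ∫ y in Ioi (0 : ℝ), y ^ (Module.finrank ℝ F - 1) •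
      (Iio R).indicator (fun t : ℝ => t ^ (-q)) y =
      R ^ ((Module.finrank ℝ F : ℝ) - q) / (Module.finrank ℝ F - q) := by
    calc
      _ = ∫ y in Ioi (0 : ℝ), (Iio R).indicator
            (fun t : ℝ => t ^ ((Module.finrank ℝ F : ℝ) - 1 - q)) y := by
          refine setIntegral_congr_fun measurableSet_Ioi fun y (hy : 0 < y) => ?_
          by_cases hyR : y < R
          · simp only [indicator, mem_Iio, hyR, if_true, smul_eq_mul]
            rw [← Real.rpow_natCast, ← Real.rpow_add hy, Nat.cast_sub hn, Nat.cast_one,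
              ← sub_eq_add_neg]
          · simp [hyR]
      _ = ∫ y in (0 : ℝ)..R, y ^ ((Module.finrank ℝ F : ℝ) - 1 - q) := by
          rw [setIntegral_indicator measurableSet_Iio, Ioi_inter_Iio, ← integral_Ioc_eq_integral_Ioo,
            intervalIntegral.integral_of_le hR]
      _ = _ := by
          rw [integral_rpow (Or.inl (by linarith)),
            show (Module.finrank ℝ F : ℝ) - 1 - q + 1 = Module.finrank ℝ F - q by ring,
            Real.zero_rpow (by linarith), sub_zero]
  rw [hrad]
  simp [mul_assoc]

end RadialPowers

section ThinRegion

variable {ι : Type*} [Fintype ι]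

lemma integrableOn_ball_prod_abs_rpow {p : ℝ} (hp : p < 1) (R : ℝ) :
    IntegrableOn (fun y : EuclideanSpace ℝ ι => ∏ i, |y i| ^ (-p)) (ball 0 R) := by
  have h1 : Integrable ((ball (0 : ℝ) R).indicator fun t : ℝ => ‖t‖ ^ (-p)) := by
    rw [integrable_indicator_iff measurableSet_ball]
    exact integrableOn_ball_norm_rpow volume (by simpa using hp) R
  have h2 := (PiLp.volume_preserving_ofLp ι).integrable_comp_of_integrable
    (Integrable.fintype_prod (μ := fun _ : ι => (volume : Measure ℝ)) fun _ => h1)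
  refine h2.integrableOn.congr_fun (fun y hy => ?_) measurableSet_ball
  refine Finset.prod_congr rfl fun i _ => ?_
  have hi : y i ∈ ball (0 : ℝ) R := by
    rw [mem_ball_zero_iff] at hy ⊢
    exact (PiLp.norm_apply_le y i).trans_lt hy
  exact indicator_of_mem hi _

lemma ae_forall_coord_ne_zero : ∀ᵐ y : EuclideanSpace ℝ ι, ∀ i, y i ≠ 0 := by
  rw [ae_all_iff]
  intro i
  refine (PiLp.volume_preserving_ofLp ι).quasiMeasurePreserving.ae (p := fun x => x i ≠ 0) ?_
  have := Measure.pi_hyperplane (fun _ : ι => (volume : Measure ℝ)) i 0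
  rw [ae_iff]
  simpa using! this

lemma norm_rpow_neg_card_le_prod {δ : ℝ} (hδ : 0 < δ) (j : ι) {y : EuclideanSpace ℝ ι}
    (hy : ∀ i, y i ≠ 0) (hyj : 2 * δ * |y j| ≤ ‖y‖ ^ 2) :
    ‖y‖ ^ (-(Fintype.card ι : ℝ)) ≤
      (2 * δ) ^ (-(1 / 2 : ℝ)) * ∏ i, |y i| ^ (-(1 - 1 / (2 * (Fintype.card ι : ℝ)))) := by
  classical
  have hcard : 1 ≤ Fintype.card ι := Fintype.card_pos_iff.2 ⟨j⟩
  set n : ℝ := (Fintype.card ι : ℝ)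
  have hn1 : 1 ≤ n := Nat.one_le_cast.2 hcard
  have hinv : 1 / (2 * n) ≤ 1 / 2 := one_div_le_one_div_of_le two_pos (by linarith)
  have hle : ∀ i, |y i| ≤ ‖y‖ := fun i => PiLp.norm_apply_le y i
  have hpos : ∀ i, 0 < |y i| := fun i => abs_pos.2 (hy i)
  have hN : 0 < ‖y‖ := (hpos j).trans_le (hle j)
  have hrest : ‖y‖ ^ (-((n - 1) * (1 - 1 / (2 * n)))) ≤
      ∏ i ∈ Finset.univ.erase j, |y i| ^ (-(1 - 1 / (2 * n))) := by
    calc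
      _ = ∏ i ∈ Finset.univ.erase j, ‖y‖ ^ (-(1 - 1 / (2 * n))) := by
          rw [Finset.prod_const, Finset.card_erase_of_mem (Finset.mem_univ j), Finset.card_univ,
            ← Real.rpow_mul_natCast hN.le, Nat.cast_sub hcard, Nat.cast_one]
          congr 1
          ring
      _ ≤ _ := Finset.prod_le_prod (fun i _ => by positivity) fun i _ =>
          Real.rpow_le_rpow_of_nonpos (hpos i) (hle i) (by linarith)
  have hhalf : (2 * δ) ^ (1 / 2 : ℝ) * ‖y‖ ^ (-1 : ℝ) ≤ |y j| ^ (-(1 / 2 : ℝ)) := by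
    have h := Real.rpow_le_rpow_of_nonpos (z := -(1 / 2 : ℝ)) (hpos j)
      ((le_div_iff₀' (by positivity)).2 hyj) (by norm_num)
    refine le_trans (le_of_eq ?_) h
    rw [Real.div_rpow (by positivity) (by positivity), ← Real.rpow_natCast,
      ← Real.rpow_mul hN.le, Real.rpow_neg (x := 2 * δ) (by positivity), div_inv_eq_mul, mul_comm]
    norm_num
  have hfac : (2 * δ) ^ (1 / 2 : ℝ) * ‖y‖ ^ (-1 : ℝ) * ‖y‖ ^ (-(1 / 2 - 1 / (2 * n))) ≤
      |y j| ^ (-(1 - 1 / (2 * n))) := by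
    have h : |y j| ^ (-(1 - 1 / (2 * n))) =
        |y j| ^ (-(1 / 2 : ℝ)) * |y j| ^ (-(1 / 2 - 1 / (2 * n))) := by
      rw [← Real.rpow_add (hpos j)]
      congr 1
      ring
    rw [h]
    exact mul_le_mul hhalf (Real.rpow_le_rpow_of_nonpos (hpos j) (hle j) (by linarith))
      (by positivity) (by positivity)
  rw [← Finset.mul_prod_erase _ _ (Finset.mem_univ j)]
  calc
    ‖y‖ ^ (-n) = (2 * δ) ^ (-(1 / 2 : ℝ)) *
        (((2 * δ) ^ (1 / 2 : ℝ) * ‖y‖ ^ (-1 : ℝ) * ‖y‖ ^ (-(1 / 2 - 1 / (2 * n)))) *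
          ‖y‖ ^ (-((n - 1) * (1 - 1 / (2 * n))))) := by
        have h1 : (2 * δ) ^ (-(1 / 2 : ℝ)) * (2 * δ) ^ (1 / 2 : ℝ) = 1 := by
          rw [← Real.rpow_add (by positivity)]
          simp
        have h2 : -n = -1 + -(1 / 2 - 1 / (2 * n)) + -((n - 1) * (1 - 1 / (2 * n))) := by
          field_simp
          ring
        rw [h2, Real.rpow_add hN, Real.rpow_add hN]
        linear_combination (-(‖y‖ ^ (-1 : ℝ) * ‖y‖ ^ (-(1 / 2 - 1 / (2 * n))) *
          ‖y‖ ^ (-((n - 1) * (1 - 1 / (2 * n)))))) * h1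
    _ ≤ _ := by gcongr

lemma integrableOn_ball_indicator_norm_rpow_neg_card {δ : ℝ} (hδ : 0 < δ) (j : ι) (R : ℝ) :
    IntegrableOn ({y : EuclideanSpace ℝ ι | 2 * δ * |y j| ≤ ‖y‖ ^ 2}.indicator
      fun y => ‖y‖ ^ (-(Fintype.card ι : ℝ))) (ball 0 R) := by
  have hcard : 0 < Fintype.card ι := Fintype.card_pos_iff.2 ⟨j⟩
  have hp : 1 - 1 / (2 * (Fintype.card ι : ℝ)) < 1 := by
    have : (0 : ℝ) < 1 / (2 * (Fintype.card ι : ℝ)) := by positivity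
    linarith
  refine ((integrableOn_ball_prod_abs_rpow (ι := ι) hp R).const_mul
    ((2 * δ) ^ (-(1 / 2 : ℝ)))).mono' ?_ ?_
  · refine ((measurable_norm.pow_const _).indicator ?_).aestronglyMeasurable
    exact measurableSet_le (by fun_prop) (by fun_prop)
  · filter_upwards [ae_restrict_of_ae ae_forall_coord_ne_zero] with y hy
    rw [Real.norm_of_nonneg (indicator_nonneg (fun _ _ => by positivity) _)]
    by_cases hyA : y ∈ {y : EuclideanSpace ℝ ι | 2 * δ * |y j| ≤ ‖y‖ ^ 2}
    · rw [indicator_of_mem hyA]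
      exact norm_rpow_neg_card_le_prod hδ j hy hyA
    · rw [indicator_of_notMem hyA]
      positivity

end ThinRegion

section Symmetrization

variable {d : ℕ} {E : Set (EuclideanSpace ℝ (Fin d))}

lemma chiDiff_of_mem {y : EuclideanSpace ℝ (Fin d)} (hy : y ∈ E) : chiDiff E y = -1 := by
  simp [chiDiff, hy]

lemma chiDiff_of_notMem {y : EuclideanSpace ℝ (Fin d)} (hy : y ∉ E) : chiDiff E y = 1 := by
  simp [chiDiff, hy]

lemma abs_chiDiff (y : EuclideanSpace ℝ (Fin d)) : |chiDiff E y| = 1 := by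
  by_cases hy : y ∈ E
  · simp [chiDiff_of_mem hy]
  · simp [chiDiff_of_notMem hy]

lemma measurable_chiDiff (hE : MeasurableSet E) : Measurable (chiDiff E) :=
  (measurable_const.indicator hE.compl).sub (measurable_const.indicator hE)

/-- The even part of `chiDiff E`. -/
noncomputable def chiDiffEven (E : Set (EuclideanSpace ℝ (Fin d)))
    (y : EuclideanSpace ℝ (Fin d)) : ℝ :=
  (chiDiff E y + chiDiff E (-y)) / 2

lemma measurable_chiDiffEven (hE : MeasurableSet E) : Measurable (chiDiffEven E) :=
  ((measurable_chiDiff hE).add ((measurable_chiDiff hE).comp measurable_neg)).div_const 2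

lemma abs_chiDiffEven_le_one (y : EuclideanSpace ℝ (Fin d)) : |chiDiffEven E y| ≤ 1 := by
  have h := abs_add_le (chiDiff E y) (chiDiff E (-y))
  rw [abs_chiDiff, abs_chiDiff] at h
  rw [chiDiffEven, abs_div, abs_two]
  linarith

lemma integrableOn_chiDiff_mul (hE : MeasurableSet E) {S : Set (EuclideanSpace ℝ (Fin d))}
    {k : EuclideanSpace ℝ (Fin d) → ℝ} (hk : IntegrableOn k S) :
    IntegrableOn (fun y => chiDiff E y * k y) S :=
  hk.bdd_mul (c := 1) (measurable_chiDiff hE).aestronglyMeasurable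
    (Eventually.of_forall fun y => (abs_chiDiff y).le)

lemma setIntegral_chiDiff_mul_of_even (hE : MeasurableSet E)
    {S : Set (EuclideanSpace ℝ (Fin d))} (hSm : MeasurableSet S) (hS : ∀ y, -y ∈ S ↔ y ∈ S)
    {k : EuclideanSpace ℝ (Fin d) → ℝ} (hk : ∀ y, k (-y) = k y) (hki : IntegrableOn k S) :
    ∫ y in S, chiDiff E y * k y = ∫ y in S, chiDiffEven E y * k y := by
  have hind : ∀ y, S.indicator (fun y => chiDiff E (-y) * k y) y =
      S.indicator (fun y => chiDiff E y * k y) (-y) := by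
    intro y
    by_cases hy : y ∈ S <;> simp [hy, hS, hk]
  have hint := integrableOn_chiDiff_mul hE hki
  have hneg : IntegrableOn (fun y => chiDiff E (-y) * k y) S := by
    rw [← integrable_indicator_iff hSm] at hint ⊢
    simpa only [← hind] using hint.comp_neg
  have heq : ∫ y in S, chiDiff E (-y) * k y = ∫ y in S, chiDiff E y * k y := by
    rw [← integral_indicator hSm, ← integral_indicator hSm]
    simp only [hind]
    exact integral_neg_eq_self _ _
  have hsum : ∀ y, chiDiffEven E y * k y =
      (1 / 2) * (chiDiff E y * k y + chiDiff E (-y) * k y) := by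
    intro y
    rw [chiDiffEven]
    ring
  simp only [hsum]
  rw [integral_const_mul, integral_add hint hneg, heq]
  ring

lemma ed_eq_single (hd : 0 < d) :
    ed d = EuclideanSpace.single (⟨d - 1, by omega⟩ : Fin d) 1 := by
  simp [ed, hd]

lemma mem_ball_smul_single_iff {ι : Type*} [Fintype ι] [DecidableEq ι] {δ : ℝ} (hδ : 0 < δ)
    (j : ι) (y : EuclideanSpace ℝ ι) :
    y ∈ ball (δ • EuclideanSpace.single j (1 : ℝ)) δ ↔ ‖y‖ ^ 2 < 2 * δ * y j := by
  rw [mem_ball, dist_eq_norm, ← sq_lt_sq₀ (norm_nonneg _) hδ.le, norm_sub_sq_real,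
    real_inner_smul_right, norm_smul, EuclideanSpace.inner_single_right]
  simp only [Real.norm_eq_abs, PiLp.norm_single, sq_abs, norm_one, mul_one,
    starRingEnd_apply, star_trivial, one_mul]
  constructor <;> intro h <;> linarith

lemma chiDiffEven_eq_zero (hd : 0 < d) {δ : ℝ} (hδ : 0 < δ)
    (hin : ball (-(δ • ed d)) δ ⊆ E) (hout : ball (δ • ed d) δ ⊆ Eᶜ)
    {y : EuclideanSpace ℝ (Fin d)} (hy : ‖y‖ ^ 2 < 2 * δ * |y ⟨d - 1, by omega⟩|) :
    chiDiffEven E y = 0 := by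
  have key : ∀ z : EuclideanSpace ℝ (Fin d), ‖z‖ ^ 2 < 2 * δ * z ⟨d - 1, by omega⟩ →
      z ∉ E ∧ -z ∈ E := by
    intro z hz
    rw [← mem_ball_smul_single_iff hδ, ← ed_eq_single hd] at hz
    refine ⟨hout hz, hin ?_⟩
    rwa [mem_ball, dist_neg_neg]
  rcases abs_cases (y ⟨d - 1, by omega⟩) with ⟨h, -⟩ | ⟨h, -⟩
  · rw [h] at hy
    obtain ⟨h1, h2⟩ := key y hy
    simp [chiDiffEven, chiDiff_of_notMem h1, chiDiff_of_mem h2]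
  · rw [h] at hy
    obtain ⟨h1, h2⟩ := key (-y) (by simpa using hy)
    rw [neg_neg] at h2
    simp [chiDiffEven, chiDiff_of_notMem h1, chiDiff_of_mem h2]

end Symmetrization

section Limits

variable {d : ℕ} {E : Set (EuclideanSpace ℝ (Fin d))} {δ R : ℝ}

lemma abs_chiDiffEven_mul_rpow_le (hd : 0 < d) (hδ : 0 < δ)
    (hin : ball (-(δ • ed d)) δ ⊆ E) (hout : ball (δ • ed d) δ ⊆ Eᶜ) (hR : 1 ≤ R)
    {s : ℝ} (hs : s ∈ Ioc (-1 : ℝ) 0) {y : EuclideanSpace ℝ (Fin d)} (hy : y ∈ ball 0 R) :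
    |chiDiffEven E y * ‖y‖ ^ (-((d : ℝ) + s))| ≤
      R * {y : EuclideanSpace ℝ (Fin d) | 2 * δ * |y ⟨d - 1, by omega⟩| ≤ ‖y‖ ^ 2}.indicator
        (fun y => ‖y‖ ^ (-(Fintype.card (Fin d) : ℝ))) y := by
  have hd1 : (1 : ℝ) ≤ d := by exact_mod_cast hd
  rw [mem_ball_zero_iff] at hy
  by_cases hyA : y ∈ {y : EuclideanSpace ℝ (Fin d) | 2 * δ * |y ⟨d - 1, by omega⟩| ≤ ‖y‖ ^ 2}
  · rw [indicator_of_mem hyA, Fintype.card_fin, abs_mul,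
      abs_of_nonneg (a := ‖y‖ ^ _) (by positivity)]
    refine (mul_le_of_le_one_left (by positivity) (abs_chiDiffEven_le_one y)).trans ?_
    rcases (norm_nonneg y).eq_or_lt with h0 | h0
    · rw [← h0, Real.zero_rpow (by linarith [hs.1])]
      positivity
    · rw [neg_add, Real.rpow_add h0, mul_comm]
      gcongr
      calc
        ‖y‖ ^ (-s) ≤ R ^ (-s) := Real.rpow_le_rpow h0.le hy.le (by linarith [hs.2])
        _ ≤ R ^ (1 : ℝ) := Real.rpow_le_rpow_of_exponent_le hR (by linarith [hs.1])
        _ = R := Real.rpow_one R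
  · rw [indicator_of_notMem hyA, chiDiffEven_eq_zero hd hδ hin hout (not_le.1 hyA)]
    simp

lemma tendsto_integral_chiDiffEven_mul_rpow (hd : 0 < d) (hE : MeasurableSet E) (hδ : 0 < δ)
    (hin : ball (-(δ • ed d)) δ ⊆ E) (hout : ball (δ • ed d) δ ⊆ Eᶜ) (hR : 1 ≤ R) :
    Tendsto (fun s : ℝ => ∫ y in ball 0 R, chiDiffEven E y * ‖y‖ ^ (-((d : ℝ) + s))) (𝓝[<] 0)
      (𝓝 (∫ y in ball 0 R, chiDiffEven E y * ‖y‖ ^ (-(d : ℝ)))) := by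
  have hd1 : (1 : ℝ) ≤ d := by exact_mod_cast hd
  refine tendsto_integral_filter_of_dominated_convergence _ ?_ ?_
    ((integrableOn_ball_indicator_norm_rpow_neg_card hδ ⟨d - 1, by omega⟩ R).const_mul R) ?_
  · exact Eventually.of_forall fun s =>
      ((measurable_chiDiffEven hE).mul (measurable_norm.pow_const _)).aestronglyMeasurable
  · filter_upwards [Ioo_mem_nhdsLT (show (-1 : ℝ) < 0 by norm_num)] with s hs
    filter_upwards [ae_restrict_mem measurableSet_ball] with y hy
    exact abs_chiDiffEven_mul_rpow_le hd hδ hin hout hR ⟨hs.1, hs.2.le⟩ hy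
  · refine Eventually.of_forall fun y => Tendsto.const_mul _ ?_
    have hexp : Tendsto (fun s : ℝ => -((d : ℝ) + s)) (𝓝[<] 0) (𝓝 (-(d : ℝ))) := by
      refine tendsto_nhdsWithin_of_tendsto_nhds ?_
      exact Continuous.tendsto' (by fun_prop) _ _ (by simp)
    rcases (norm_nonneg y).eq_or_lt with h0 | h0
    · rw [← h0, Real.zero_rpow (by linarith)]
      refine tendsto_const_nhds.congr' ?_
      filter_upwards [Ioo_mem_nhdsLT (show (-1 : ℝ) < 0 by norm_num)] with s hs
      rw [Real.zero_rpow (by linarith [hs.1])]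
    · exact tendsto_const_nhds.rpow hexp (Or.inl h0.ne')

lemma tendsto_integral_annulus_chiDiff_div_rpow (hd : 0 < d) (hE : MeasurableSet E) (hδ : 0 < δ)
    (hin : ball (-(δ • ed d)) δ ⊆ E) (hout : ball (δ • ed d) δ ⊆ Eᶜ) (hR : 1 ≤ R) :
    Tendsto (fun r : ℝ => ∫ y in ball 0 R \ ball 0 r, chiDiff E y / ‖y - 0‖ ^ (d : ℝ)) (𝓝[>] 0)
      (𝓝 (∫ y in ball 0 R, chiDiffEven E y * ‖y‖ ^ (-(d : ℝ)))) := by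
  have hd1 : (1 : ℝ) ≤ d := by exact_mod_cast hd
  have hlim : Tendsto (fun r : ℝ => ∫ y in ball 0 R,
      (ball 0 r)ᶜ.indicator (fun y => chiDiffEven E y * ‖y‖ ^ (-(d : ℝ))) y) (𝓝[>] 0)
      (𝓝 (∫ y in ball 0 R, chiDiffEven E y * ‖y‖ ^ (-(d : ℝ)))) := by
    refine tendsto_integral_filter_of_dominated_convergence _ ?_ ?_
      ((integrableOn_ball_indicator_norm_rpow_neg_card hδ ⟨d - 1, by omega⟩ R).const_mul R) ?_
    · exact Eventually.of_forall fun r => (((measurable_chiDiffEven hE).mul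
        (measurable_norm.pow_const _)).indicator measurableSet_ball.compl).aestronglyMeasurable
    · refine Eventually.of_forall fun r => ?_
      filter_upwards [ae_restrict_mem measurableSet_ball] with y hy
      refine (norm_indicator_le_norm_self _ _).trans ?_
      simpa using abs_chiDiffEven_mul_rpow_le hd hδ hin hout hR (s := 0) (by simp) hy
    · refine Eventually.of_forall fun y => tendsto_const_nhds.congr' ?_
      rcases (norm_nonneg y).eq_or_lt with h0 | h0
      · refine Eventually.of_forall fun r => ?_
        simp [indicator, ← h0, Real.zero_rpow (show -(d : ℝ) ≠ 0 by linarith)]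
      · filter_upwards [Ioo_mem_nhdsGT h0] with r hr
        rw [indicator_of_mem]
        simpa using hr.2.le
  refine hlim.congr' ?_
  filter_upwards [self_mem_nhdsWithin] with r (hr : 0 < r)
  have hk : IntegrableOn (fun y : EuclideanSpace ℝ (Fin d) => ‖y‖ ^ (-(d : ℝ)))
      (ball 0 R \ ball 0 r) := by
    refine IntegrableOn.of_bound (C := r ^ (-(d : ℝ)))
      ((measure_mono sdiff_subset).trans_lt measure_ball_lt_top)
      (measurable_norm.pow_const _).aestronglyMeasurable ?_
    filter_upwards [ae_restrict_mem (measurableSet_ball.diff measurableSet_ball)] with y hy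
    have hyr : r ≤ ‖y‖ := by simpa using hy.2
    rw [Real.norm_of_nonneg (by positivity)]
    exact Real.rpow_le_rpow_of_nonpos hr hyr (by linarith)
  have hsym := setIntegral_chiDiff_mul_of_even hE (measurableSet_ball.diff measurableSet_ball)
    (S := ball 0 R \ ball 0 r) (fun y => by simp) (fun y => by rw [norm_neg]) hk
  rw [setIntegral_indicator measurableSet_ball.compl, ← sdiff_eq, ← hsym]
  simp only [sub_zero, Real.rpow_neg (norm_nonneg _), div_eq_mul_inv]

lemma Ks_zero_eq (hd : 0 < d) (hE : MeasurableSet E) (hR : 0 ≤ R) (hER : E ⊆ ball 0 R)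
    {s : ℝ} (hs : s < 0) :
    Ks s E 0 = (∫ y in ball 0 R, chiDiffEven E y * ‖y‖ ^ (-((d : ℝ) + s))) +
      d * unitBallVol d * (R ^ (-s) / s) := by
  have : Nonempty (Fin d) := ⟨⟨0, hd⟩⟩
  have hq : (d : ℝ) + s < Module.finrank ℝ (EuclideanSpace ℝ (Fin d)) := by
    simpa using hs
  have hk := integrableOn_ball_norm_rpow (volume : Measure (EuclideanSpace ℝ (Fin d))) hq R
  have hball := integral_ball_norm_rpow (volume : Measure (EuclideanSpace ℝ (Fin d))) hq hR
  rw [finrank_euclideanSpace_fin, show (d : ℝ) - (d + s) = -s by ring] at hball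
  rw [← setIntegral_chiDiff_mul_of_even hE measurableSet_ball (fun y => by simp)
    (fun y => by rw [norm_neg]) hk]
  have hKs : Ks s E 0 = ∫ y in ball 0 R,
      (chiDiff E y * ‖y‖ ^ (-((d : ℝ) + s)) - ‖y‖ ^ (-((d : ℝ) + s))) := by
    rw [Ks, ← integral_const_mul, ← integral_indicator hE, ← integral_indicator measurableSet_ball]
    congr 1
    ext y
    by_cases hy : y ∈ E
    · rw [indicator_of_mem hy, indicator_of_mem (hER hy), chiDiff_of_mem hy, zero_sub, norm_neg,
        Real.rpow_neg (norm_nonneg _)]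
      ring
    · simp [indicator, hy, chiDiff_of_notMem hy]
  rw [hKs, integral_sub (integrableOn_chiDiff_mul hE hk) hk, hball, unitBallVol,
    Measure.real, div_neg]
  ring

end Limits

lemma tendsto_rpow_neg_sub_one_div {R : ℝ} (hR : 0 < R) :
    Tendsto (fun s : ℝ => (R ^ (-s) - 1) / s) (𝓝[<] 0) (𝓝 (-Real.log R)) := by
  have h : HasDerivAt (fun s : ℝ => R ^ (-s)) (-Real.log R) 0 := by
    simpa using (hasDerivAt_neg (0 : ℝ)).const_rpow hR
  refine (h.tendsto_slope.mono_left (nhdsWithin_mono _ fun s hs => ne_of_lt hs)).congr fun s => ?_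
  simp [slope_def_field]

/-- as `s → 0⁻`, `K^s(0,E) - d ω_d/s → H^0(0,E)`; in particular
`s · K^s(0,E) → d ω_d`. -/
theorem stmt_14 (d : ℕ) (hd : 0 < d) (E : Set (EuclideanSpace ℝ (Fin d)))
    (hEc : IsCompact E) (h0 : (0 : EuclideanSpace ℝ (Fin d)) ∈ frontier E)
    (δ : ℝ) (hδ : 0 < δ)
    (hin : Metric.ball (-(δ • ed d)) δ ⊆ E)
    (hout : Metric.ball (δ • ed d) δ ⊆ Eᶜ) :
    Tendsto (fun s : ℝ => Ks s E 0 - (d : ℝ) * unitBallVol d / s)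
      (nhdsWithin 0 (Set.Iio 0)) (nhds (H0 E 0)) ∧
    Tendsto (fun s : ℝ => s * Ks s E 0) (nhdsWithin 0 (Set.Iio 0))
      (nhds ((d : ℝ) * unitBallVol d)) := by
  have hcl : E ⊆ ball 0 (diam E + 1) := by
    intro y hy
    rw [mem_ball]
    have := dist_le_diam_of_mem hEc.isBounded hy (hEc.isClosed.frontier_subset h0)
    linarith
  have hR : 1 ≤ diam E + 1 := by linarith [diam_nonneg (s := E)]
  have hE : MeasurableSet E := hEc.measurableSet
  have hmain : Tendsto (fun s : ℝ => Ks s E 0 - (d : ℝ) * unitBallVol d / s)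
      (𝓝[<] 0) (𝓝 (H0 E 0)) := by
    rw [H0, (tendsto_integral_annulus_chiDiff_div_rpow hd hE hδ hin hout hR).limUnder_eq,
      sub_eq_add_neg, ← mul_neg]
    refine ((tendsto_integral_chiDiffEven_mul_rpow hd hE hδ hin hout hR).add
      ((tendsto_rpow_neg_sub_one_div (by linarith)).const_mul _)).congr' ?_
    filter_upwards [self_mem_nhdsWithin] with s (hs : s < 0)
    rw [Ks_zero_eq hd hE (by linarith) hcl hs]
    ring
  refine ⟨hmain, ?_⟩
  have hid : Tendsto (fun s : ℝ => s) (𝓝[<] 0) (𝓝 0) := tendsto_id.mono_left nhdsWithin_le_nhds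
  have hlim := (hid.mul hmain).add_const ((d : ℝ) * unitBallVol d)
  rw [zero_mul, zero_add] at hlim
  refine hlim.congr' ?_
  filter_upwards [self_mem_nhdsWithin] with s (hs : s < 0)
  have := hs.ne
  field_simp
  ring
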